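/- Let d ≥ 2 and let S ⊆ ℕ^d be a generalized numerical semigroup with embedding dimension 2d+1. Then S is almost symmetric if and only if S is symmetric; in particular no such S is pseudo-symmetric. -/

import Mathlib

/-- The set of pseudo-Frobenius elements of a submonoid of ℕ^d. -/
def PF {d : ℕ} (S : AddSubmonoid (Fin d → ℕ)) : Set (Fin d → ℕ) :=
  {h | h ∉ S ∧ ∀ s ∈ S, s ≠ 0 → h + s ∈ S}

/-- Maximal gaps of a submonoid of ℕ^d, w.r.t. the componentwise order. -/
def FA {d : ℕ} (S : AddSubmonoid (Fin d → ℕ)) : Set (Fin d → ℕ) :=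
  {h | h ∉ S ∧ ∀ g, g ∉ S → h ≤ g → g = h}

/-- S is almost symmetric: FA(S) = {f} and f − p ∈ PF(S) for all p ∈ PF(S) \ {f}. -/
def AlmostSymmetric {d : ℕ} (S : AddSubmonoid (Fin d → ℕ)) : Prop :=
  ∃ f, FA S = {f} ∧ ∀ p ∈ PF S, p ≠ f → f - p ∈ PF S

open Finset in
/-- The set of coordinates at which a vector is nonzero. -/
def coordSupport {d : ℕ} (g : Fin d → ℕ) : Finset (Fin d) := univ.filter (g · ≠ 0)

/-- The elements of `A` with a prescribed coordinate support. -/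
def withSupport {d : ℕ} (A : Finset (Fin d → ℕ)) (s : Finset (Fin d)) : Finset (Fin d → ℕ) :=
  A.filter (coordSupport · = s)

lemma mem_coordSupport {d : ℕ} {g : Fin d → ℕ} {k : Fin d} : k ∈ coordSupport g ↔ g k ≠ 0 := by
  simp [coordSupport]

lemma mem_withSupport {d : ℕ} {A : Finset (Fin d → ℕ)} {s : Finset (Fin d)} {g : Fin d → ℕ} :
    g ∈ withSupport A s ↔ g ∈ A ∧ ∀ k, g k ≠ 0 ↔ k ∈ s := by
  simp [withSupport, Finset.ext_iff, mem_coordSupport]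

/-- Counting generators by support: singletons, pairs through `i` and the remaining pairs through `j` are distinct supports. -/
lemma sum_card_withSupport_le {d : ℕ} (A : Finset (Fin d → ℕ)) {i j : Fin d} (hij : i ≠ j) :
    ∑ k, (withSupport A {k}).card + ∑ k ∈ Finset.univ.erase i, (withSupport A {i, k}).card +
      ∑ k ∈ (Finset.univ.erase i).erase j, (withSupport A {j, k}).card ≤ A.card := by
  have hA : A.card = ∑ s, (withSupport A s).card :=
    Finset.card_eq_sum_card_fiberwise (fun _ _ => Finset.mem_coe.2 (Finset.mem_univ _))
  have h1 : ∑ k, (withSupport A {k}).card =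
      ∑ s ∈ Finset.univ.image (fun k : Fin d => ({k} : Finset (Fin d))),
        (withSupport A s).card := by
    rw [Finset.sum_image]
    intro a _ b _ h
    simpa using h
  have h2 : ∑ k ∈ Finset.univ.erase i, (withSupport A {i, k}).card =
      ∑ s ∈ (Finset.univ.erase i).image (fun k : Fin d => ({i, k} : Finset (Fin d))),
        (withSupport A s).card := by
    rw [Finset.sum_image]
    intro a ha b hb h
    have := Finset.ext_iff.1 h a
    simp at ha hb this
    tauto
  have h3 : ∑ k ∈ (Finset.univ.erase i).erase j, (withSupport A {j, k}).card =
      ∑ s ∈ ((Finset.univ.erase i).erase j).image (fun k : Fin d => ({j, k} : Finset (Fin d))),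
        (withSupport A s).card := by
    rw [Finset.sum_image]
    intro a ha b hb h
    have := Finset.ext_iff.1 h a
    simp at ha hb this
    tauto
  rw [h1, h2, h3, ← Finset.sum_union, ← Finset.sum_union, hA]
  · exact Finset.sum_le_sum_of_subset (Finset.subset_univ _)
  · rw [Finset.disjoint_left]
    intro s hs hs'
    simp only [Finset.mem_union, Finset.mem_image, Finset.mem_erase, Finset.mem_univ,
      true_and, and_true] at hs hs'
    obtain ⟨k, ⟨hkj, hki⟩, rfl⟩ := hs'
    obtain ⟨l, hl⟩ | ⟨l, hl, h⟩ := hs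
    · have h1 := Finset.ext_iff.1 hl j
      have h2 := Finset.ext_iff.1 hl k
      simp at h1 h2
      grind
    · have h1 := Finset.ext_iff.1 h i
      simp at h1
      grind
  · rw [Finset.disjoint_left]
    intro s hs hs'
    simp only [Finset.mem_image, Finset.mem_erase, Finset.mem_univ,
      true_and, and_true] at hs hs'
    obtain ⟨k, hk, rfl⟩ := hs'
    obtain ⟨l, hl⟩ := hs
    have h1 := Finset.ext_iff.1 hl i
    have h2 := Finset.ext_iff.1 hl k
    simp at h1 h2
    grind

lemma coprime_of_closure_pair {a b F : ℕ} (h : ∀ x, F < x → x ∈ AddSubmonoid.closure {a, b}) :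
    a.Coprime b := by
  have hdvd : ∀ x, F < x → a.gcd b ∣ x := fun x hx => by
    obtain ⟨m, n, rfl⟩ := (AddSubmonoid.mem_closure_pair a b x).1 (h x hx)
    exact dvd_add (Dvd.dvd.mul_left (Nat.gcd_dvd_left a b) m)
      (Dvd.dvd.mul_left (Nat.gcd_dvd_right a b) n)
  have := (Nat.dvd_add_right (hdvd (F + 1) (by omega))).1 (hdvd (F + 1 + 1) (by omega))
  exact Nat.dvd_one.1 this

lemma one_lt_of_closure_pair {a b F : ℕ} (h : ∀ x, F < x → x ∈ AddSubmonoid.closure {a, b})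
    (h1 : 1 ∉ AddSubmonoid.closure {a, b}) : 1 < a ∧ 1 < b := by
  have hc := coprime_of_closure_pair h
  have ha : a ≠ 1 := by
    rintro rfl
    exact h1 (AddSubmonoid.subset_closure (by simp))
  have hb : b ≠ 1 := by
    rintro rfl
    exact h1 (AddSubmonoid.subset_closure (by simp))
  have ha0 : a ≠ 0 := by
    rintro rfl
    simp at hc
    omega
  have hb0 : b ≠ 0 := by
    rintro rfl
    simp at hc
    omega
  omega

/-- A numerical semigroup generated by two elements is symmetric. -/
lemma closure_pair_symmetric {a b F x y : ℕ}
    (h : ∀ x, F < x → x ∈ AddSubmonoid.closure {a, b}) (hF : F ∉ AddSubmonoid.closure {a, b})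
    (h1 : 1 ∉ AddSubmonoid.closure {a, b}) (hx : x ∉ AddSubmonoid.closure {a, b})
    (hxy : x + y = F) : y ∈ AddSubmonoid.closure {a, b} := by
  have hc := coprime_of_closure_pair h
  obtain ⟨ha, hb⟩ := one_lt_of_closure_pair h h1
  have hg : IsGreatest {k | k ∉ AddSubmonoid.closure {a, b}} F :=
    ⟨hF, fun k hk => not_lt.1 fun hlt => hk (h k hlt)⟩
  have hFeq : F = a * b - a - b := hg.unique (frobeniusNumber_pair hc ha hb)
  have hle : a + b ≤ a * b := by nlinarith
  have hFz : (x : ℤ) + y = a * b - a - b := by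
    have : F + a + b = a * b := by omega
    rw [← hxy] at this
    have : (x : ℤ) + y + a + b = a * b := by exact_mod_cast this
    linarith
  have hbez : (1 : ℤ) = a * a.gcdA b + b * a.gcdB b := by
    rw [← Nat.gcd_eq_gcd_ab, Nat.Coprime.gcd_eq_one hc, Nat.cast_one]
  set s := a.gcdA b
  set t := a.gcdB b
  have hb0 : (0 : ℤ) < b := by omega
  set u : ℤ := (x * s) % b
  have hu0 : 0 ≤ u := Int.emod_nonneg _ hb0.ne'
  have hub : u < b := Int.emod_lt_of_pos _ hb0
  obtain ⟨v, hv⟩ : ∃ v : ℤ, (x : ℤ) = u * a + v * b := by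
    refine ⟨x * t + (x * s / b) * a, ?_⟩
    have := Int.emod_add_mul_ediv (x * s) b
    change u + _ = _ at this
    linear_combination (x : ℤ) * hbez - a * this
  have hvneg : v ≤ -1 := by
    by_contra hvn
    apply hx
    rw [AddSubmonoid.mem_closure_pair]
    refine ⟨u.toNat, v.toNat, ?_⟩
    zify
    rw [nsmul_eq_mul, nsmul_eq_mul]
    push_cast
    rw [Int.toNat_of_nonneg hu0, Int.toNat_of_nonneg (by omega), hv]
  rw [AddSubmonoid.mem_closure_pair]
  refine ⟨(b - 1 - u).toNat, (-1 - v).toNat, ?_⟩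
  zify
  rw [nsmul_eq_mul, nsmul_eq_mul]
  push_cast
  rw [Int.toNat_of_nonneg (by omega), Int.toNat_of_nonneg (by omega)]
  linear_combination hv - hFz

section

variable {d : ℕ} {A : Finset (Fin d → ℕ)} {f : Fin d → ℕ}

lemma eq_single_of_forall_ne {g : Fin d → ℕ} {i : Fin d} (h : ∀ k, k ≠ i → g k = 0) :
    g = Pi.single i (g i) := by
  ext k
  by_cases hk : k = i
  · subst hk
    simp
  · simp [hk, h k hk]

lemma single_mem_closure_iff {i : Fin d} {x : ℕ} :
    Pi.single i x ∈ AddSubmonoid.closure (A : Set (Fin d → ℕ)) ↔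
      x ∈ AddSubmonoid.closure ((withSupport A {i}).image (· i) : Set ℕ) := by
  constructor
  · intro h
    suffices H : ∀ s ∈ AddSubmonoid.closure (A : Set (Fin d → ℕ)), (∃ k, k ≠ i ∧ s k ≠ 0) ∨
        s i ∈ AddSubmonoid.closure ((withSupport A {i}).image (· i) : Set ℕ) by
      obtain ⟨k, hk, h'⟩ | h' := H _ h
      · simp [hk] at h'
      · simpa using h'
    intro s hs
    induction hs using AddSubmonoid.closure_induction with
    | mem g hg =>
      by_cases hk : ∃ k, k ≠ i ∧ g k ≠ 0
      · exact Or.inl hk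
      right
      by_cases h0 : g i = 0
      · rw [h0]
        exact zero_mem _
      apply AddSubmonoid.subset_closure
      rw [Finset.mem_coe, Finset.mem_image]
      refine ⟨g, mem_withSupport.2 ⟨hg, fun k => ?_⟩, rfl⟩
      grind
    | zero => exact Or.inr (zero_mem _)
    | add s t _ _ hs ht =>
      obtain ⟨k, hk, h⟩ | hs := hs
      · exact Or.inl ⟨k, hk, by simp [h]⟩
      obtain ⟨k, hk, h⟩ | ht := ht
      · exact Or.inl ⟨k, hk, by simp [h]⟩
      exact Or.inr (add_mem hs ht)
  · intro h
    induction h using AddSubmonoid.closure_induction with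
    | mem y hy =>
      rw [Finset.mem_coe, Finset.mem_image] at hy
      obtain ⟨g, hg, rfl⟩ := hy
      rw [mem_withSupport] at hg
      apply AddSubmonoid.subset_closure
      rw [← eq_single_of_forall_ne (fun k hk => by simpa [hk] using hg.2 k)]
      exact hg.1
    | zero => simp
    | add x y _ _ hx hy =>
      rw [Pi.single_add]
      exact add_mem hx hy

lemma single_mem_of_lt (hf : ∀ g, g ∉ AddSubmonoid.closure (A : Set (Fin d → ℕ)) → g ≤ f)
    {i : Fin d} {x : ℕ} (hx : f i < x) :
    Pi.single i x ∈ AddSubmonoid.closure (A : Set (Fin d → ℕ)) := by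
  by_contra h
  have := hf _ h i
  simp at this
  omega

lemma one_le_card_withSupport_singleton
    (hf : ∀ g, g ∉ AddSubmonoid.closure (A : Set (Fin d → ℕ)) → g ≤ f) (i : Fin d) :
    1 ≤ (withSupport A {i}).card := by
  by_contra h
  have h0 : withSupport A {i} = ∅ := Finset.card_eq_zero.1 (by omega)
  have := single_mem_closure_iff.1 (single_mem_of_lt hf (Nat.lt_succ_self (f i)))
  simp [h0] at this

/-- At most two naturals generate the same monoid as some pair, which is degenerate if there is
at most one of them. -/
lemma exists_closure_pair {B : Finset ℕ} (hB : B.card ≤ 2) :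
    ∃ a b, AddSubmonoid.closure (B : Set ℕ) = AddSubmonoid.closure {a, b} ∧
      (B.card ≤ 1 → a = b) := by
  obtain h | h | h : B.card = 0 ∨ B.card = 1 ∨ B.card = 2 := by omega
  · refine ⟨0, 0, ?_, by simp⟩
    rw [Finset.card_eq_zero.1 h, Finset.coe_empty, AddSubmonoid.closure_empty,
      Set.pair_eq_singleton]
    exact AddSubmonoid.closure_singleton_zero.symm
  · obtain ⟨a, rfl⟩ := Finset.card_eq_one.1 h
    exact ⟨a, a, by simp, by simp⟩
  · obtain ⟨a, b, -, rfl⟩ := Finset.card_eq_two.1 h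
    exact ⟨a, b, by simp, by omega⟩

lemma two_le_card_withSupport_singleton
    (hf : ∀ g, g ∉ AddSubmonoid.closure (A : Set (Fin d → ℕ)) → g ≤ f) {i : Fin d}
    (hi : Pi.single i 1 ∉ AddSubmonoid.closure (A : Set (Fin d → ℕ))) :
    2 ≤ (withSupport A {i}).card := by
  by_contra hcard
  have hB : ((withSupport A {i}).image (· i)).card ≤ 1 := Finset.card_image_le.trans (by omega)
  obtain ⟨a, b, hab, h⟩ := exists_closure_pair (hB.trans one_le_two)
  have hlt : ∀ x, f i < x → x ∈ AddSubmonoid.closure {a, b} := fun x hx => by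
    rw [← hab]
    exact single_mem_closure_iff.1 (single_mem_of_lt hf hx)
  rw [single_mem_closure_iff, hab] at hi
  have h1 := one_lt_of_closure_pair hlt hi
  have hc := coprime_of_closure_pair hlt
  rw [h hB, Nat.coprime_self] at hc
  omega

lemma exists_mem_withSupport_pair
    (hf : ∀ g, g ∉ AddSubmonoid.closure (A : Set (Fin d → ℕ)) → g ≤ f) {i k : Fin d}
    (hi : Pi.single i 1 ∉ AddSubmonoid.closure (A : Set (Fin d → ℕ))) (hik : i ≠ k) :
    ∃ g ∈ withSupport A {i, k}, g i = 1 := by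
  have hmem : Pi.single i 1 + Pi.single k (f k + 1) ∈
      AddSubmonoid.closure (A : Set (Fin d → ℕ)) := by
    by_contra h
    have := hf _ h k
    simp [hik.symm] at this
  suffices H : ∀ s ∈ AddSubmonoid.closure (A : Set (Fin d → ℕ)), s i = 0 ∨ 2 ≤ s i ∨
      (∃ j, j ≠ i ∧ j ≠ k ∧ s j ≠ 0) ∨ ∃ g ∈ withSupport A {i, k}, g i = 1 by
    obtain h | h | ⟨j, hj, hj', h⟩ | h := H _ hmem
    · simp at h
    · simp [hik] at h
    · simp [hj, hj'] at h
    · exact h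
  intro s hs
  induction hs using AddSubmonoid.closure_induction with
  | mem g hg =>
    by_cases h1 : g i = 1
    · by_cases hj : ∃ j, j ≠ i ∧ j ≠ k ∧ g j ≠ 0
      · exact Or.inr (Or.inr (Or.inl hj))
      by_cases hk : g k = 0
      · refine absurd (AddSubmonoid.subset_closure hg) ?_
        rwa [eq_single_of_forall_ne (by grind : ∀ j, j ≠ i → g j = 0), h1]
      · refine Or.inr (Or.inr (Or.inr ⟨g, mem_withSupport.2 ⟨hg, fun j => ?_⟩, h1⟩))
        simp only [Finset.mem_insert, Finset.mem_singleton]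
        grind
    · omega
  | zero => exact Or.inl rfl
  | add s t _ _ hs ht =>
    simp only [Pi.add_apply]
    obtain hs | hs | ⟨j, hj, hj', h⟩ | hs := hs
    · obtain ht | ht | ⟨j, hj, hj', h⟩ | ht := ht
      · omega
      · omega
      · exact Or.inr (Or.inr (Or.inl ⟨j, hj, hj', by omega⟩))
      · tauto
    · omega
    · exact Or.inr (Or.inr (Or.inl ⟨j, hj, hj', by omega⟩))
    · tauto

lemma single_apply_mem_of_forall_eq_one
    (hf : ∀ g, g ∉ AddSubmonoid.closure (A : Set (Fin d → ℕ)) → g ≤ f) {i j : Fin d}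
    (hij : i ≠ j) (hj : Pi.single j 1 ∉ AddSubmonoid.closure (A : Set (Fin d → ℕ)))
    (hone : ∀ g ∈ withSupport A {i, j}, g i = 1) :
    Pi.single i (f i) ∈ AddSubmonoid.closure (A : Set (Fin d → ℕ)) := by
  have hmem : Pi.single i (f i + 1) + Pi.single j 1 ∈
      AddSubmonoid.closure (A : Set (Fin d → ℕ)) := by
    by_contra h
    have := hf _ h i
    simp [hij] at this
  suffices H : ∀ s ∈ AddSubmonoid.closure (A : Set (Fin d → ℕ)),
      (∃ k, k ≠ i ∧ k ≠ j ∧ s k ≠ 0) ∨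
      (s j = 0 ∧ Pi.single i (s i) ∈ AddSubmonoid.closure (A : Set (Fin d → ℕ))) ∨
      (s j = 1 ∧ ∃ x, s i = x + 1 ∧
        Pi.single i x ∈ AddSubmonoid.closure (A : Set (Fin d → ℕ))) ∨ 2 ≤ s j by
    obtain ⟨k, hk, hk', h⟩ | ⟨h, -⟩ | ⟨-, x, hx, h⟩ | h := H _ hmem
    · simp [hk, hk'] at h
    · simp at h
    · simp [hij] at hx
      rwa [hx]
    · simp [hij.symm] at h
  intro s hs
  induction hs using AddSubmonoid.closure_induction with
  | mem g hg =>
    by_cases hk : ∃ k, k ≠ i ∧ k ≠ j ∧ g k ≠ 0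
    · exact Or.inl hk
    right
    obtain h0 | h1 | h2 : g j = 0 ∨ g j = 1 ∨ 2 ≤ g j := by omega
    · refine Or.inl ⟨h0, AddSubmonoid.subset_closure ?_⟩
      rwa [← eq_single_of_forall_ne (by grind : ∀ k, k ≠ i → g k = 0)]
    · right; left
      refine ⟨h1, 0, ?_, by simp⟩
      rw [zero_add]
      by_cases h0 : g i = 0
      · refine absurd (AddSubmonoid.subset_closure hg) ?_
        rwa [eq_single_of_forall_ne (by grind : ∀ k, k ≠ j → g k = 0), h1]
      · refine hone g (mem_withSupport.2 ⟨hg, fun k => ?_⟩)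
        simp only [Finset.mem_insert, Finset.mem_singleton]
        grind
    · exact Or.inr (Or.inr h2)
  | zero => exact Or.inr (Or.inl (by simp))
  | add s t _ _ hs ht =>
    simp only [Pi.add_apply]
    obtain ⟨k, hk, hk', h⟩ | hs := hs
    · exact Or.inl ⟨k, hk, hk', by omega⟩
    obtain ⟨k, hk, hk', h⟩ | ht := ht
    · exact Or.inl ⟨k, hk, hk', by omega⟩
    right
    obtain ⟨hs, hsm⟩ | ⟨hs, x, hx, hxm⟩ | hs := hs
    · obtain ⟨ht, htm⟩ | ⟨ht, y, hy, hym⟩ | ht := ht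
      · exact Or.inl ⟨by omega, by rw [Pi.single_add]; exact add_mem hsm htm⟩
      · refine Or.inr (Or.inl ⟨by omega, s i + y, by omega, ?_⟩)
        rw [Pi.single_add]
        exact add_mem hsm hym
      · omega
    · obtain ⟨ht, htm⟩ | ⟨ht, y, hy, hym⟩ | ht := ht
      · refine Or.inr (Or.inl ⟨by omega, x + t i, by omega, ?_⟩)
        rw [Pi.single_add]
        exact add_mem hxm htm
      · omega
      · omega
    · omega

lemma mem_of_coord_eq_zero {S : AddSubmonoid (Fin d → ℕ)} {i : Fin d}
    (hS : ∀ k, k ≠ i → Pi.single k 1 ∈ S) {v : Fin d → ℕ} (hv : v i = 0) : v ∈ S := by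
  rw [← Finset.univ_sum_single v]
  refine sum_mem fun k _ => ?_
  by_cases hk : k = i
  · subst hk
    simp [hv]
  · have := nsmul_mem (hS k hk) (v k)
    rwa [← Pi.single_smul, smul_eq_mul, mul_one] at this

lemma mem_of_le_of_coord_eq {S : AddSubmonoid (Fin d → ℕ)} {i : Fin d}
    (hS : ∀ k, k ≠ i → Pi.single k 1 ∈ S) {u v : Fin d → ℕ} (hu : u ∈ S) (huv : u ≤ v)
    (h : u i = v i) : v ∈ S := by
  rw [← add_tsub_cancel_of_le huv]
  exact add_mem hu (mem_of_coord_eq_zero hS (by simp [h]))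

/-- If only one coordinate vector is missing and there is a single generator supported on
`{i, j}`, then no two gaps add up to the largest one. -/
lemma false_of_card_withSupport_pair
    (hf : ∀ g, g ∉ AddSubmonoid.closure (A : Set (Fin d → ℕ)) → g ≤ f) {i j : Fin d}
    (hij : i ≠ j) (hi : Pi.single i 1 ∉ AddSubmonoid.closure (A : Set (Fin d → ℕ)))
    (hS : ∀ k, k ≠ i → Pi.single k 1 ∈ AddSubmonoid.closure (A : Set (Fin d → ℕ)))
    (hcard : (withSupport A {i, j}).card ≤ 1) {p q : Fin d → ℕ}
    (hp : p ∉ AddSubmonoid.closure (A : Set (Fin d → ℕ)))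
    (hq : q ∉ AddSubmonoid.closure (A : Set (Fin d → ℕ)))
    (hfm : f ∉ AddSubmonoid.closure (A : Set (Fin d → ℕ))) (hpq : p + q = f) : False := by
  obtain ⟨g, hg, hgi⟩ := exists_mem_withSupport_pair hf hi hij
  obtain ⟨hgA, hgs⟩ := mem_withSupport.1 hg
  have hgS := AddSubmonoid.subset_closure (Finset.mem_coe.2 hgA)
  have hex : ∃ n, 0 < n ∧ Pi.single i n ∈ AddSubmonoid.closure (A : Set (Fin d → ℕ)) :=
    ⟨f i + 1, by omega, single_mem_of_lt hf (by omega)⟩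
  classical
  obtain ⟨n, ⟨hn0, hn⟩, hmin⟩ : ∃ n, (0 < n ∧ Pi.single i n ∈
      AddSubmonoid.closure (A : Set (Fin d → ℕ))) ∧ ∀ m, 0 < m → Pi.single i m ∈
      AddSubmonoid.closure (A : Set (Fin d → ℕ)) → n ≤ m :=
    ⟨Nat.find hex, Nat.find_spec hex, fun m h0 hm => Nat.find_min' hex ⟨h0, hm⟩⟩
  have hn1 : n ≠ 1 := by
    rintro rfl
    exact hi hn
  have hKpos : 0 < g j := Nat.pos_of_ne_zero ((hgs j).2 (by simp))
  have hupper : ∀ v, v ∉ AddSubmonoid.closure (A : Set (Fin d → ℕ)) →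
      v j < (v i % n) * g j := by
    intro v hv
    by_contra! hle
    refine hv (mem_of_le_of_coord_eq hS (add_mem (nsmul_mem hn (v i / n))
      (nsmul_mem hgS (v i % n))) ?_ ?_)
    · intro k
      have hdm := Nat.div_add_mod' (v i) n
      by_cases hki : k = i
      · subst hki
        simp [hgi, hdm]
      · by_cases hkj : k = j
        · subst hkj
          simpa [hki] using hle
        · have := hgs k
          simp [hki, hkj] at this
          simp [hki, this]
    · simp [hgi, Nat.div_add_mod']
  have hlower : (n - 1) * g j ≤ f j + 1 := by
    by_contra! hlt
    suffices H : ∀ s ∈ AddSubmonoid.closure (A : Set (Fin d → ℕ)),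
        (∃ k, k ≠ i ∧ k ≠ j ∧ s k ≠ 0) ∨ n ≤ s i ∨ s i * g j ≤ s j by
      have hnot : Pi.single i (n - 1) + Pi.single j (f j + 1) ∉
          AddSubmonoid.closure (A : Set (Fin d → ℕ)) := by
        intro h
        obtain ⟨k, hk, hk', h⟩ | h | h := H _ h
        · simp [hk, hk'] at h
        · simp [hij] at h
          omega
        · simp [hij, hij.symm] at h
          omega
      have := hf _ hnot j
      simp [hij.symm] at this
    intro s hs
    induction hs using AddSubmonoid.closure_induction with
    | mem a ha =>
      by_cases hk : ∃ k, k ≠ i ∧ k ≠ j ∧ a k ≠ 0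
      · exact Or.inl hk
      right
      by_cases hai : a i = 0
      · right
        simp [hai]
      by_cases haj : a j = 0
      · left
        refine hmin _ (Nat.pos_of_ne_zero hai) (AddSubmonoid.subset_closure ?_)
        rwa [← eq_single_of_forall_ne (by grind : ∀ k, k ≠ i → a k = 0)]
      · right
        have : a = g := Finset.card_le_one.1 hcard a (mem_withSupport.2 ⟨ha, fun k => by
          simp only [Finset.mem_insert, Finset.mem_singleton]
          grind⟩) g hg
        rw [this, hgi, one_mul]
    | zero => simp
    | add s t _ _ hs ht =>
      simp only [Pi.add_apply]
      obtain ⟨k, hk, hk', h⟩ | hs := hs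
      · exact Or.inl ⟨k, hk, hk', by omega⟩
      obtain ⟨k, hk, hk', h⟩ | ht := ht
      · exact Or.inl ⟨k, hk, hk', by omega⟩
      right
      rw [add_mul]
      omega
  have hfr : n - 1 ≤ f i % n := by
    have h := hupper f hfm
    exact Nat.le_of_mul_le_mul_right (c := g j) (by omega) hKpos
  have hpn := hupper p hp
  have hqn := hupper q hq
  have hpl := Nat.mod_lt (p i) hn0
  have hql := Nat.mod_lt (q i) hn0
  have hfi : p i + q i = f i := congrFun hpq i
  have hfj : p j + q j = f j := congrFun hpq j
  have hsum : p i % n + q i % n ≤ n - 1 := by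
    have := Nat.add_mod (p i) (q i) n
    rw [hfi] at this
    by_contra! hgt
    rw [Nat.mod_eq_sub_mod (a := p i % n + q i % n) (by omega),
      Nat.mod_eq_of_lt (a := p i % n + q i % n - n) (by omega)] at this
    omega
  have := Nat.mul_le_mul_right (g j) hsum
  rw [add_mul] at this
  omega

lemma not_mem_of_add_eq (hd : 2 ≤ d) (hcard : A.card = 2 * d + 1)
    (hf : ∀ g, g ∉ AddSubmonoid.closure (A : Set (Fin d → ℕ)) → g ≤ f) {p q : Fin d → ℕ}
    (hp : p ∉ AddSubmonoid.closure (A : Set (Fin d → ℕ)))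
    (hq : q ∉ AddSubmonoid.closure (A : Set (Fin d → ℕ))) (hpq : p + q = f) :
    f ∈ AddSubmonoid.closure (A : Set (Fin d → ℕ)) := by
  by_contra hfm
  have hone := one_le_card_withSupport_singleton hf
  obtain ⟨i, hi⟩ : ∃ i : Fin d,
      Pi.single i 1 ∉ AddSubmonoid.closure (A : Set (Fin d → ℕ)) := by
    by_contra! h
    refine hfm ?_
    rw [← Finset.univ_sum_single f]
    refine sum_mem fun k _ => ?_
    have := nsmul_mem (h k) (f k)
    rwa [← Pi.single_smul, smul_eq_mul, mul_one] at this
  have hpair : ∀ i k, Pi.single i 1 ∉ AddSubmonoid.closure (A : Set (Fin d → ℕ)) → i ≠ k →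
      1 ≤ (withSupport A {i, k}).card := fun i k hi hk => by
    obtain ⟨g, hg, -⟩ := exists_mem_withSupport_pair hf hi hk
    exact Finset.card_pos.2 ⟨g, hg⟩
  have hsum : ∀ (s : Finset (Fin d)) (c : Fin d → ℕ), (∀ k ∈ s, 1 ≤ c k) → s.card ≤ ∑ k ∈ s, c k :=
    fun s c h => by simpa using Finset.card_nsmul_le_sum s c 1 h
  by_cases hT : ∃ j, j ≠ i ∧ Pi.single j 1 ∉ AddSubmonoid.closure (A : Set (Fin d → ℕ))
  · obtain ⟨j, hji, hj⟩ := hT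
    have hc := sum_card_withSupport_le A hji.symm
    have hjm : j ∈ Finset.univ.erase i := by simp [hji]
    rw [← Finset.add_sum_erase _ _ (Finset.mem_univ i), ← Finset.add_sum_erase _ _ hjm,
      ← Finset.add_sum_erase _ (fun k => (withSupport A {i, k}).card) hjm] at hc
    have h1 := hsum ((Finset.univ.erase i).erase j) (fun k => (withSupport A {k}).card)
      (fun k _ => hone k)
    have h2 := hsum ((Finset.univ.erase i).erase j) (fun k => (withSupport A {i, k}).card)
      (fun k hk => hpair i k hi (by grind))
    have h3 := hsum ((Finset.univ.erase i).erase j) (fun k => (withSupport A {j, k}).card)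
      (fun k hk => hpair j k hj (by grind))
    have h4 := two_le_card_withSupport_singleton hf hi
    have h5 := two_le_card_withSupport_singleton hf hj
    have h6 := hpair i j hi hji.symm
    have hE : ((Finset.univ.erase i).erase j).card = d - 2 := by
      rw [Finset.card_erase_of_mem hjm, Finset.card_erase_of_mem (Finset.mem_univ _)]
      simp
      omega
    rw [hE] at h1 h2 h3
    have hle : (withSupport A {i, j}).card ≤ 1 := by omega
    have hd2 : d = 2 := by omega
    obtain ⟨g, hg, hgi⟩ := exists_mem_withSupport_pair hf hi hji.symm
    obtain ⟨g', hg', hgj⟩ := exists_mem_withSupport_pair hf hj hji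
    have hfi := single_apply_mem_of_forall_eq_one hf hji.symm hj
      (fun a ha => Finset.card_le_one.1 hle a ha g hg ▸ hgi)
    rw [Finset.pair_comm] at hle
    have hfj := single_apply_mem_of_forall_eq_one hf hji hi
      (fun a ha => Finset.card_le_one.1 hle a ha g' hg' ▸ hgj)
    refine hfm ?_
    convert add_mem hfi hfj
    ext k
    have huniv : k = i ∨ k = j := by
      omega
    obtain rfl | rfl := huniv <;> simp [hji, hji.symm]
  · push Not at hT
    obtain ⟨j, hji⟩ : ∃ j : Fin d, j ≠ i :=
      have : Nontrivial (Fin d) := Fin.nontrivial_iff_two_le.2 hd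
      exists_ne i
    have haxis : ∀ v, v ∉ AddSubmonoid.closure (A : Set (Fin d → ℕ)) →
        Pi.single i (v i) ∉ AddSubmonoid.closure (A : Set (Fin d → ℕ)) := fun v hv h =>
      hv (mem_of_le_of_coord_eq hT h (by intro k; by_cases hk : k = i <;> aesop) (by simp))
    by_cases hα : (withSupport A {i}).card ≤ 2
    · obtain ⟨a, b, hab, -⟩ := exists_closure_pair
        (Finset.card_image_le.trans hα : ((withSupport A {i}).image (· i)).card ≤ 2)
      have hiff : ∀ x, Pi.single i x ∈ AddSubmonoid.closure (A : Set (Fin d → ℕ)) ↔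
          x ∈ AddSubmonoid.closure {a, b} := fun x => by
        rw [← hab]
        exact single_mem_closure_iff
      have hpi := haxis p hp
      have hqi := haxis q hq
      have hfi := haxis f hfm
      rw [hiff] at hpi hqi hfi hi
      exact hqi (closure_pair_symmetric (fun x hx => (hiff x).1 (single_mem_of_lt hf hx))
        hfi hi hpi (congrFun hpq i))
    · refine false_of_card_withSupport_pair hf hji.symm hi hT ?_ hp hq hfm hpq
      have hc := sum_card_withSupport_le A hji.symm
      have hjm : j ∈ Finset.univ.erase i := by simp [hji]
      rw [← Finset.add_sum_erase _ _ (Finset.mem_univ i),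
        ← Finset.add_sum_erase _ (fun k => (withSupport A {i, k}).card) hjm] at hc
      have h1 := hsum (Finset.univ.erase i) (fun k => (withSupport A {k}).card)
        (fun k _ => hone k)
      have h2 := hsum ((Finset.univ.erase i).erase j) (fun k => (withSupport A {i, k}).card)
        (fun k hk => hpair i k hi (by grind))
      rw [Finset.card_erase_of_mem hjm] at h2
      rw [Finset.card_erase_of_mem (Finset.mem_univ _), Finset.card_univ, Fintype.card_fin]
        at h1 h2
      omega

end

lemma FA_subset_PF {d : ℕ} (S : AddSubmonoid (Fin d → ℕ)) : FA S ⊆ PF S := by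
  rintro f ⟨hf, hmax⟩
  refine ⟨hf, fun s _ hs0 => ?_⟩
  by_contra h
  exact hs0 (add_eq_left.1 (hmax _ h le_self_add))

lemma exists_mem_FA_le {d : ℕ} {S : AddSubmonoid (Fin d → ℕ)}
    (hfin : {x : Fin d → ℕ | x ∉ S}.Finite) {g : Fin d → ℕ} (hg : g ∉ S) :
    ∃ f ∈ FA S, g ≤ f := by
  obtain ⟨f, hgf, hf⟩ := hfin.exists_le_maximal (a := g) hg
  exact ⟨f, ⟨hf.prop, fun h hh hle => le_antisymm (hf.le_of_ge hh hle) hle⟩, hgf⟩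

/-- for d ≥ 2 and embedding dimension 2d+1, almost symmetric ↔ symmetric;
in particular no such S is pseudo-symmetric. -/
theorem almost_symmetric_iff_symmetric_edim_2d_plus_1
    (d : ℕ) (hd : 2 ≤ d)
    (S : AddSubmonoid (Fin d → ℕ))
    (hfin : {x : Fin d → ℕ | x ∉ S}.Finite)
    (A : Finset (Fin d → ℕ))
    (hgen : AddSubmonoid.closure (A : Set (Fin d → ℕ)) = S)
    (hmin : ∀ B ⊂ A, AddSubmonoid.closure (B : Set (Fin d → ℕ)) ≠ S)
    (hcard : A.card = 2 * d + 1) :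
    (AlmostSymmetric S ↔ (PF S).ncard = 1) ∧
    ¬ (AlmostSymmetric S ∧ (PF S).ncard = 2) := by
  have hiff : AlmostSymmetric S ↔ (PF S).ncard = 1 := by
    rw [Set.ncard_eq_one]
    constructor
    · rintro ⟨f, hFA, hsymm⟩
      have hfFA : f ∈ FA S := hFA ▸ rfl
      have hle : ∀ g, g ∉ S → g ≤ f := fun g hg => by
        obtain ⟨f', hf', hgf'⟩ := exists_mem_FA_le hfin hg
        rw [hFA] at hf'
        exact hf' ▸ hgf'
      refine ⟨f, Set.Subset.antisymm (fun p hp => ?_)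
        (Set.singleton_subset_iff.2 (FA_subset_PF S hfFA))⟩
      by_contra hne
      have hq := hsymm p hp hne
      subst hgen
      exact hfFA.1 (not_mem_of_add_eq hd hcard hle hp.1 hq.1
        (add_tsub_cancel_of_le (hle p hp.1)))
    · rintro ⟨f, hPF⟩
      have hfPF : f ∈ PF S := hPF ▸ rfl
      obtain ⟨f', hf', -⟩ := exists_mem_FA_le hfin hfPF.1
      have hsub : FA S ⊆ {f} := hPF ▸ FA_subset_PF S
      refine ⟨f, Set.Subset.antisymm hsub (Set.singleton_subset_iff.2 (hsub hf' ▸ hf')), ?_⟩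
      intro p hp hne
      rw [hPF] at hp
      exact absurd hp hne
  refine ⟨hiff, fun ⟨h1, h2⟩ => ?_⟩
  have := hiff.1 h1
  omega
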